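/- arXiv:2005.14632 — 3 statements merged into one kernel-verified Lean document; each statement's English description precedes it below -/
import Mathlib

section
/- Let σ₀ > 1, θ ∈ (-π, π] and n ∈ ℕ. Then there exists a real number ρ with 1 < ρ < σ₀ and there exist n pairwise distinct complex numbers s₁, …, s_n, each satisfying ρ < Re s_j < σ₀, such that Arg(S_a(s_j)) = θ for every j = 1, …, n. -/
open Real

/-- A finite exponential sum with nonnegative real part on `ℝ` has a mean value with
nonnegative real part. -/
lemma re_sum_filter_eq_zero_nonneg {ι : Type*} (s : Finset ι) (c : ι → ℂ) (l : ι → ℝ)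
    (h : ∀ t : ℝ, 0 ≤ (∑ i ∈ s, c i * Complex.exp (l i * t * Complex.I)).re) :
    0 ≤ (∑ i ∈ s with l i = 0, c i).re := by
  have hint (v : NNReal) (i : ι) : MeasureTheory.Integrable
      (fun t : ℝ ↦ c i * Complex.exp (l i * t * Complex.I))
      (ProbabilityTheory.gaussianReal 0 v) := by
    refine MeasureTheory.Integrable.of_bound (C := ‖c i‖)
      (Continuous.aestronglyMeasurable (by fun_prop)) (.of_forall fun t ↦ ?_)
    rw [norm_mul, ← Complex.ofReal_mul, Complex.norm_exp_ofReal_mul_I, mul_one]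
  have hpos (v : NNReal) :
      0 ≤ (∑ i ∈ s, c i * Complex.exp (-(v * (l i : ℂ) ^ 2 / 2))).re := by
    have key : ∑ i ∈ s, c i * Complex.exp (-(v * (l i : ℂ) ^ 2 / 2)) =
        ∫ t : ℝ, ∑ i ∈ s, c i * Complex.exp (l i * t * Complex.I)
          ∂(ProbabilityTheory.gaussianReal 0 v) := by
      rw [MeasureTheory.integral_finsetSum _ fun i _ ↦ hint v i]
      refine Finset.sum_congr rfl fun i _ ↦ ?_
      rw [MeasureTheory.integral_const_mul, ← MeasureTheory.charFun_apply_real,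
        ProbabilityTheory.charFun_gaussianReal]
      simp
    have hre := integral_re (𝕜 := ℂ)
      (MeasureTheory.integrable_finsetSum s fun i _ ↦ hint v i)
    rw [key]
    simp only [RCLike.re_eq_complex_re] at hre
    rw [← hre]
    exact MeasureTheory.integral_nonneg h
  have hlim : Filter.Tendsto
      (fun v : NNReal ↦ (∑ i ∈ s, c i * Complex.exp (-(v * (l i : ℂ) ^ 2 / 2))).re)
      Filter.atTop (nhds (∑ i ∈ s with l i = 0, c i).re) := by
    refine (Complex.continuous_re.tendsto _).comp ?_
    rw [Finset.sum_filter]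
    refine tendsto_finsetSum _ fun i _ ↦ ?_
    split_ifs with hi
    · simp [hi]
    · rw [← mul_zero (c i)]
      refine tendsto_const_nhds.mul ?_
      rw [tendsto_zero_iff_norm_tendsto_zero]
      have hn (v : NNReal) : ‖Complex.exp (-(v * (l i : ℂ) ^ 2 / 2))‖ =
          Real.exp (-((v : ℝ) * (l i ^ 2 / 2))) := by
        rw [Complex.norm_exp]
        norm_cast
        rw [← mul_div_assoc]
      simp_rw [hn]
      refine Real.tendsto_exp_neg_atTop_nhds_zero.comp ?_
      exact (NNReal.tendsto_coe_atTop.2 Filter.tendsto_id).atTop_mul_const (by positivity)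
  exact ge_of_tendsto' hlim hpos

lemma card_filter_mul_mem_divisors {N p : ℕ} (hp : p.Prime) (hN : Squarefree N) (hpN : p ∣ N) :
    2 * (N.divisors.filter fun m ↦ m * p ∈ N.divisors).card = N.divisors.card := by
  obtain ⟨M, rfl⟩ := hpN
  have hcop : Nat.Coprime p M := Nat.coprime_of_squarefree_mul hN
  have hM : M ≠ 0 := by rintro rfl; simp at hN
  have : ((p * M).divisors.filter fun m ↦ m * p ∈ (p * M).divisors) = M.divisors := by
    ext m
    simp only [Finset.mem_filter, Nat.mem_divisors, mul_comm m p,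
      Nat.mul_dvd_mul_iff_left hp.pos]
    exact ⟨fun h ↦ ⟨h.2.1, hM⟩, fun h ↦ ⟨⟨h.1.mul_left p, mul_ne_zero hp.ne_zero hM⟩,
      h.1, mul_ne_zero hp.ne_zero hM⟩⟩
  rw [this, hcop.card_divisors_mul, hp.divisors, Finset.card_pair hp.one_lt.ne]

/-- A Riesz product argument: a Dirichlet polynomial over primes with completely multiplicative
unimodular twist reaches at least half of its absolute sum. -/
lemma half_sum_le_of_forall_sum_re_le (f : ℕ → ℂ)
    (hmul : ∀ m n : ℕ, m ≠ 0 → n ≠ 0 → f (m * n) = f m * f n)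
    (hnorm : ∀ n : ℕ, n ≠ 0 → ‖f n‖ = 1) (F : Finset ℕ) (hF : ∀ p ∈ F, p.Prime)
    (w : ℕ → ℝ) (B : ℝ)
    (hB : ∀ t : ℝ, ∑ p ∈ F, w p * (f p * Complex.exp (Real.log p * t * Complex.I)).re ≤ B) :
    (∑ p ∈ F, w p) / 2 ≤ B := by
  classical
  set N := ∏ p ∈ F, p
  have hN0 : N ≠ 0 := Finset.prod_ne_zero_iff.2 fun p hp ↦ (hF p hp).ne_zero
  have hNsq : Squarefree N := by
    refine Finset.squarefree_prod_of_pairwise_isCoprime ?_ fun p hp ↦ (hF p hp).squarefree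
    intro p hp q hq hpq
    exact Nat.coprime_iff_isRelPrime.1 ((Nat.coprime_primes (hF p hp) (hF q hq)).2 hpq)
  set D := N.divisors
  have hD0 : ∀ m ∈ D, m ≠ 0 := fun m hm ↦ (Nat.pos_of_mem_divisors hm).ne'
  have h1F : 1 ∉ F := fun h ↦ Nat.not_prime_one (hF 1 h)
  let g : ℕ → ℂ := fun q ↦ if q = 1 then (B : ℂ) else -(w q * f q)
  let c : ℕ × ℕ × ℕ → ℂ := fun x ↦ g x.1 * (f x.2.1 * starRingEnd ℂ (f x.2.2))
  let l : ℕ × ℕ × ℕ → ℝ := fun x ↦ Real.log x.1 + (Real.log x.2.1 - Real.log x.2.2)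
  have hg : ∀ p ∈ F, g p = -(w p * f p) := fun p hp ↦ if_neg (hF p hp).ne_one
  have hmean := re_sum_filter_eq_zero_nonneg (insert 1 F ×ˢ (D ×ˢ D)) c l (fun t ↦ by
    let E : ℕ → ℂ := fun q ↦ Complex.exp (Real.log q * t * Complex.I)
    have hE (x : ℕ × ℕ × ℕ) : c x * Complex.exp (l x * t * Complex.I) =
        (g x.1 * E x.1) * ((f x.2.1 * E x.2.1) * starRingEnd ℂ (f x.2.2 * E x.2.2)) := by
      have : Complex.exp (l x * t * Complex.I) =
          E x.1 * (E x.2.1 * starRingEnd ℂ (E x.2.2)) := by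
        simp only [E, l, ← Complex.exp_conj, ← Complex.exp_add]
        congr 1
        simp only [map_mul, Complex.conj_ofReal, Complex.conj_I]
        push_cast
        ring
      rw [this, map_mul]
      simp only [c]
      ring
    simp_rw [hE]
    rw [Finset.sum_product]
    dsimp only
    rw [← Finset.sum_mul_sum, Finset.sum_product]
    dsimp only
    rw [← Finset.sum_mul_sum, ← map_sum,
      Complex.mul_conj, Complex.re_mul_ofReal, Finset.sum_insert h1F]
    refine mul_nonneg ?_ (Complex.normSq_nonneg _)
    rw [Complex.add_re, Complex.re_sum]
    have e1 : (g 1 * E 1).re = B := by simp [g, E]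
    have e2 : ∑ p ∈ F, (g p * E p).re = -∑ p ∈ F, w p * (f p * E p).re := by
      rw [← Finset.sum_neg_distrib]
      refine Finset.sum_congr rfl fun p hp ↦ ?_
      rw [hg p hp, neg_mul, mul_assoc, Complex.neg_re, Complex.re_ofReal_mul]
    rw [e1, e2]
    linarith [hB t])
  have hl : ∀ x ∈ insert 1 F ×ˢ (D ×ˢ D), l x = 0 ↔ x.2.1 * x.1 = x.2.2 := by
    rintro ⟨q, m, n⟩ hx
    simp only [Finset.mem_product, Finset.mem_insert] at hx
    obtain ⟨hq, hm, hn⟩ := hx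
    have hq0 : q ≠ 0 := by
      rcases hq with rfl | hq
      · exact one_ne_zero
      · exact (hF q hq).ne_zero
    have hm0 := hD0 m hm
    have hn0 := hD0 n hn
    have hlog : l (q, m, n) = Real.log ((m * q : ℕ) : ℝ) - Real.log n := by
      simp only [l]
      push_cast
      rw [Real.log_mul (by exact_mod_cast hm0) (by exact_mod_cast hq0)]
      ring
    rw [hlog, sub_eq_zero]
    constructor
    · intro h
      have := Real.log_injOn_pos (Set.mem_Ioi.2 (by positivity)) (Set.mem_Ioi.2 (by positivity)) h
      exact_mod_cast this
    · intro h
      simp only at h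
      rw [h]
  rw [Finset.filter_congr hl, Finset.sum_filter, Finset.sum_product] at hmean
  have hinner (q : ℕ) (hq0 : q ≠ 0) :
      (∑ y ∈ D ×ˢ D, if y.1 * q = y.2 then c (q, y) else 0) =
        (D.filter fun m ↦ m * q ∈ D).card * (g q * starRingEnd ℂ (f q)) := by
    rw [Finset.sum_product]
    simp only [Finset.sum_ite_eq]
    rw [← Finset.sum_filter, ← nsmul_eq_mul]
    refine Finset.sum_eq_card_nsmul fun m hm ↦ ?_
    have hm0 := hD0 m (Finset.mem_filter.1 hm).1
    simp only [c]
    rw [hmul m q hm0 hq0, map_mul]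
    have := Complex.mul_conj' (f m)
    rw [hnorm m hm0, Complex.ofReal_one] at this
    linear_combination (g q * starRingEnd ℂ (f q)) * this
  rw [Finset.sum_insert h1F, hinner 1 one_ne_zero,
    Finset.sum_congr rfl fun p hp ↦ hinner p (hF p hp).ne_zero, Complex.add_re,
    Complex.re_sum] at hmean
  have hf1 : f 1 = 1 := by
    have h := hmul 1 1 one_ne_zero one_ne_zero
    have h0 : f 1 ≠ 0 := fun h ↦ by simpa [h] using hnorm 1 one_ne_zero
    exact mul_left_cancel₀ h0 (by simpa using h.symm)
  have e1 : (((D.filter fun m ↦ m * 1 ∈ D).card : ℂ) * (g 1 * starRingEnd ℂ (f 1))).re =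
      D.card * B := by
    simp [g, hf1]
  have e2 : ∀ p ∈ F,
      (((D.filter fun m ↦ m * p ∈ D).card : ℂ) * (g p * starRingEnd ℂ (f p))).re =
        -(D.card * (w p / 2)) := by
    intro p hp
    have hcard := card_filter_mul_mem_divisors (hF p hp) hNsq (Finset.dvd_prod_of_mem _ hp)
    have h2 : (D.card : ℝ) = 2 * (D.filter fun m ↦ m * p ∈ D).card := by
      exact_mod_cast hcard.symm
    have hc := Complex.mul_conj' (f p)
    rw [hnorm p (hF p hp).ne_zero] at hc
    rw [hg p hp, h2, neg_mul, mul_assoc, hc]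
    simp only [Complex.ofReal_one, one_pow, mul_one, ← Complex.ofReal_neg, ← Complex.ofReal_natCast,
      ← Complex.ofReal_mul, Complex.ofReal_re]
    ring
  rw [e1, Finset.sum_congr rfl e2, Finset.sum_neg_distrib, ← Finset.mul_sum,
    ← Finset.sum_div] at hmean
  have hDpos : (0 : ℝ) < D.card := by
    exact_mod_cast Finset.card_pos.2 ⟨1, Nat.one_mem_divisors.2 hN0⟩
  nlinarith

/-- The logarithm of the Euler product of `∑ a(n) n ^ (-s)`. -/
noncomputable def logEulerProduct (a : ℕ → ℂ) (s : ℂ) : ℂ :=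
  ∑' p : Nat.Primes, -Complex.log (1 - a p * (p : ℂ) ^ (-s))

section

variable {a : ℕ → ℂ}

lemma norm_eq_one_of_mul_of_prime (ha1 : a 1 = 1)
    (hmul : ∀ m n : ℕ, m ≠ 0 → n ≠ 0 → a (m * n) = a m * a n)
    (haprime : ∀ p : ℕ, p.Prime → ‖a p‖ = 1) (n : ℕ) (hn : n ≠ 0) : ‖a n‖ = 1 := by
  induction n using Nat.recOnMul with
  | zero => exact absurd rfl hn
  | one => simp [ha1]
  | prime p hp => exact haprime p hp
  | mul m n hm hn' =>
    obtain ⟨h1, h2⟩ := mul_ne_zero_iff.1 hn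
    rw [hmul m n h1 h2, norm_mul, hm h1, hn' h2, one_mul]

lemma exp_logEulerProduct (ha1 : a 1 = 1)
    (hmul : ∀ m n : ℕ, m ≠ 0 → n ≠ 0 → a (m * n) = a m * a n)
    (hnorm : ∀ n : ℕ, n ≠ 0 → ‖a n‖ = 1) {s : ℂ} (hs : 1 < s.re) :
    Complex.exp (logEulerProduct a s) = LSeries a s := by
  let f : ℕ →*₀ ℂ :=
    { toFun := LSeries.term a s
      map_zero' := LSeries.term_zero a s
      map_one' := by simp [ha1]
      map_mul' := fun m n ↦ by
        rcases eq_or_ne m 0 with rfl | hm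
        · simp
        rcases eq_or_ne n 0 with rfl | hn
        · simp
        rw [LSeries.term_of_ne_zero (mul_ne_zero hm hn), LSeries.term_of_ne_zero hm,
          LSeries.term_of_ne_zero hn, hmul m n hm hn, Nat.cast_mul,
          Complex.natCast_mul_natCast_cpow]
        exact mul_div_mul_comm _ _ _ _ }
  have hsum : LSeriesSummable a s :=
    LSeriesSummable_of_bounded_of_one_lt_re (fun n hn ↦ (hnorm n hn).le) hs
  have h := EulerProduct.exp_tsum_primes_log_eq_tsum (f := f) hsum.norm
  rw [LSeries, logEulerProduct]
  refine Eq.trans ?_ h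
  congr 1
  refine tsum_congr fun p ↦ ?_
  change _ = -Complex.log (1 - LSeries.term a s p)
  rw [LSeries.term_of_ne_zero p.prop.ne_zero, Complex.cpow_neg, div_eq_mul_inv]

lemma norm_mul_prime_cpow (haprime : ∀ p : ℕ, p.Prime → ‖a p‖ = 1) (p : Nat.Primes) (s : ℂ) :
    ‖a p * (p : ℂ) ^ (-s)‖ = (p : ℝ) ^ (-s.re) := by
  rw [norm_mul, haprime p p.prop, one_mul, Complex.norm_natCast_cpow_of_pos p.prop.pos,
    Complex.neg_re]

lemma prime_rpow_neg_le_half (p : Nat.Primes) {x : ℝ} (hx : 1 ≤ x) :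
    (p : ℝ) ^ (-x) ≤ 1 / 2 := by
  have hp : (2 : ℝ) ≤ p := by exact_mod_cast p.prop.two_le
  calc (p : ℝ) ^ (-x) ≤ (p : ℝ) ^ (-1 : ℝ) :=
        Real.rpow_le_rpow_of_exponent_le (by linarith) (by linarith)
    _ = 1 / (p : ℝ) := by rw [Real.rpow_neg_one, one_div]
    _ ≤ 1 / 2 := one_div_le_one_div_of_le two_pos hp

lemma norm_log_one_sub_prime_le (haprime : ∀ p : ℕ, p.Prime → ‖a p‖ = 1) (p : Nat.Primes)
    {s : ℂ} (hs : 1 ≤ s.re) :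
    ‖-Complex.log (1 - a p * (p : ℂ) ^ (-s))‖ ≤ 3 / 2 * (p : ℝ) ^ (-s.re) := by
  have h := Complex.norm_log_one_add_half_le_self (z := -(a p * (p : ℂ) ^ (-s))) (by
    rw [norm_neg, norm_mul_prime_cpow haprime]
    exact prime_rpow_neg_le_half p hs)
  rwa [norm_neg, norm_mul_prime_cpow haprime, ← sub_eq_add_neg, ← norm_neg] at h

lemma norm_log_one_sub_prime_sub_le (haprime : ∀ p : ℕ, p.Prime → ‖a p‖ = 1) (p : Nat.Primes)
    {s : ℂ} (hs : 1 ≤ s.re) :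
    ‖-Complex.log (1 - a p * (p : ℂ) ^ (-s)) - a p * (p : ℂ) ^ (-s)‖ ≤ (p : ℝ) ^ (-2 : ℝ) := by
  set z := a p * (p : ℂ) ^ (-s)
  have hzn : ‖z‖ = (p : ℝ) ^ (-s.re) := norm_mul_prime_cpow haprime p s
  have hz2 : ‖z‖ ≤ 1 / 2 := hzn ▸ prime_rpow_neg_le_half p hs
  have h := Complex.norm_log_one_add_sub_self_le (z := -z) (by rw [norm_neg]; linarith)
  have e : -Complex.log (1 - z) - z = -(Complex.log (1 + -z) - -z) := by
    rw [← sub_eq_add_neg]; ring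
  rw [e, norm_neg]
  refine h.trans ?_
  rw [norm_neg]
  have hinv : (1 - ‖z‖)⁻¹ ≤ 2 := by
    rw [inv_le_comm₀ (by linarith) two_pos]; linarith
  have hp : (1 : ℝ) ≤ p := by exact_mod_cast p.prop.one_lt.le
  calc ‖z‖ ^ 2 * (1 - ‖z‖)⁻¹ / 2 ≤ ‖z‖ ^ 2 := by nlinarith [sq_nonneg ‖z‖]
    _ ≤ ((p : ℝ) ^ (-1 : ℝ)) ^ 2 := by
        gcongr
        rw [hzn]
        exact Real.rpow_le_rpow_of_exponent_le hp (by linarith)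
    _ = (p : ℝ) ^ (-2 : ℝ) := by
        rw [← Real.rpow_natCast, ← Real.rpow_mul (by linarith)]
        norm_num

lemma summable_log_one_sub_prime (haprime : ∀ p : ℕ, p.Prime → ‖a p‖ = 1) {s : ℂ}
    (hs : 1 < s.re) :
    Summable fun p : Nat.Primes ↦ -Complex.log (1 - a p * (p : ℂ) ^ (-s)) :=
  .of_norm_bounded ((Nat.Primes.summable_rpow.2 (by linarith)).mul_left _)
    fun p ↦ norm_log_one_sub_prime_le haprime p hs.le

lemma continuous_logEulerProduct_vertical (haprime : ∀ p : ℕ, p.Prime → ‖a p‖ = 1) {x : ℝ}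
    (hx : 1 < x) : Continuous fun t : ℝ ↦ logEulerProduct a ⟨x, t⟩ := by
  refine continuous_tsum (u := fun p : Nat.Primes ↦ 3 / 2 * (p : ℝ) ^ (-x)) (fun p ↦ ?_)
    ((Nat.Primes.summable_rpow.2 (by linarith)).mul_left _)
    fun p t ↦ norm_log_one_sub_prime_le haprime p hx.le
  have hp0 : (p : ℂ) ≠ 0 := by exact_mod_cast p.prop.ne_zero
  have hline : Continuous fun t : ℝ ↦ (⟨x, t⟩ : ℂ) := by
    simp_rw [Complex.mk_eq_add_mul_I]
    fun_prop
  have hc : Continuous fun t : ℝ ↦ a p * (p : ℂ) ^ (-(⟨x, t⟩ : ℂ)) :=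
    continuous_const.mul (hline.neg.const_cpow (.inl hp0))
  refine ((continuous_const.sub hc).clog fun t ↦ ?_).neg
  refine Complex.mem_slitPlane_of_norm_lt_one (z := -(a p * (p : ℂ) ^ (-(⟨x, t⟩ : ℂ)))) ?_
  rw [norm_neg, norm_mul_prime_cpow haprime]
  exact (prime_rpow_neg_le_half p hx.le).trans_lt one_half_lt_one

lemma exists_vertical_line_le_re_mul_logEulerProduct (ha1 : a 1 = 1)
    (hmul : ∀ m n : ℕ, m ≠ 0 → n ≠ 0 → a (m * n) = a m * a n)
    (haprime : ∀ p : ℕ, p.Prime → ‖a p‖ = 1) (V : ℝ) {x₀ : ℝ} (hx₀ : 1 < x₀) :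
    ∃ x : ℝ, 1 < x ∧ x < x₀ ∧
      ∀ u : ℂ, ‖u‖ = 1 → ∃ t : ℝ, V ≤ (u * logEulerProduct a ⟨x, t⟩).re := by
  classical
  have hnorm := norm_eq_one_of_mul_of_prime ha1 hmul haprime
  have hsq : Summable fun p : Nat.Primes ↦ (p : ℝ) ^ (-2 : ℝ) :=
    Nat.Primes.summable_rpow.2 (by norm_num)
  set C := ∑' p : Nat.Primes, (p : ℝ) ^ (-2 : ℝ)
  obtain ⟨F₀, hF₀⟩ : ∃ F₀ : Finset Nat.Primes,
      2 * (V + C + 2) < ∑ p ∈ F₀, (p : ℝ) ^ (-1 : ℝ) := by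
    by_contra! h
    exact absurd (Nat.Primes.summable_rpow.1
      (summable_of_sum_le (fun p ↦ by positivity) h)) (lt_irrefl _)
  obtain ⟨x, hx1, hxx₀, hxF₀⟩ : ∃ x : ℝ, 1 < x ∧ x < x₀ ∧
      2 * (V + C + 2) < ∑ p ∈ F₀, (p : ℝ) ^ (-x) := by
    have hcont : Continuous fun x : ℝ ↦ ∑ p ∈ F₀, (p : ℝ) ^ (-x) :=
      continuous_finsetSum _ fun p _ ↦
        (Real.continuous_const_rpow (by exact_mod_cast p.prop.ne_zero)).comp continuous_neg
    have hev := (hcont.tendsto 1).eventually_const_lt hF₀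
    obtain ⟨x, ⟨h1, h2⟩, h3⟩ := (Filter.Eventually.and (Ioo_mem_nhdsGT hx₀)
      (hev.filter_mono nhdsWithin_le_nhds)).exists
    exact ⟨x, h1, h2, h3⟩
  refine ⟨x, hx1, hxx₀, fun u hu ↦ ?_⟩
  have hw : Summable fun p : Nat.Primes ↦ (p : ℝ) ^ (-x) :=
    Nat.Primes.summable_rpow.2 (by linarith)
  obtain ⟨F, hF₀F, hF⟩ : ∃ F : Finset Nat.Primes, F₀ ⊆ F ∧
      ∑' p : Nat.Primes, (p : ℝ) ^ (-x) - 1 < ∑ p ∈ F, (p : ℝ) ^ (-x) := by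
    have h := hw.hasSum.eventually_const_lt (sub_one_lt _)
    obtain ⟨F, h1, h2⟩ := ((Filter.eventually_ge_atTop F₀).and h).exists
    exact ⟨F, h1, h2⟩
  have hFV : 2 * (V + C + 2) < ∑ p ∈ F, (p : ℝ) ^ (-x) :=
    hxF₀.trans_le (Finset.sum_le_sum_of_subset_of_nonneg hF₀F fun _ _ _ ↦ by positivity)
  obtain ⟨t, ht⟩ : ∃ t : ℝ, (∑ p ∈ F, (p : ℝ) ^ (-x)) / 2 - 1 <
      ∑ p ∈ F, (p : ℝ) ^ (-x) * (a p * u * Complex.exp (Real.log p * t * Complex.I)).re := by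
    by_contra! h
    have := half_sum_le_of_forall_sum_re_le
      (fun n ↦ a n * u ^ ArithmeticFunction.cardFactors n)
      (fun m n hm hn ↦ by
        simp only [hmul m n hm hn, ArithmeticFunction.cardFactors_mul hm hn, pow_add]
        ring)
      (fun n hn ↦ by simp [hnorm n hn, hu])
      (F.map ⟨fun p : Nat.Primes ↦ (p : ℕ), Subtype.val_injective⟩)
      (fun p hp ↦ by
        obtain ⟨q, -, rfl⟩ := Finset.mem_map.1 hp
        exact q.prop)
      (fun p ↦ (p : ℝ) ^ (-x)) ((∑ p ∈ F, (p : ℝ) ^ (-x)) / 2 - 1)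
      (fun t ↦ by
        rw [Finset.sum_map]
        refine (Finset.sum_congr rfl fun p _ ↦ ?_).trans_le (h t)
        change (p : ℝ) ^ (-x) * (a p * u ^ ArithmeticFunction.cardFactors p * _).re = _
        rw [ArithmeticFunction.cardFactors_apply_prime p.prop, pow_one]
        rfl)
    rw [Finset.sum_map] at this
    change (∑ p ∈ F, (p : ℝ) ^ (-x)) / 2 ≤ _ at this
    linarith
  refine ⟨-t, ?_⟩
  set s : ℂ := ⟨x, -t⟩ with hs
  have hz (p : Nat.Primes) : (u * (a p * (p : ℂ) ^ (-s))).re =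
      (p : ℝ) ^ (-x) * (a p * u * Complex.exp (Real.log p * t * Complex.I)).re := by
    have hp0 : (p : ℂ) ≠ 0 := by exact_mod_cast p.prop.ne_zero
    have hpow : (p : ℂ) ^ (-s) =
        ((p : ℝ) ^ (-x) : ℝ) * Complex.exp (Real.log p * t * Complex.I) := by
      have : -s = ((-x : ℝ) : ℂ) + t * Complex.I := by
        apply Complex.ext <;> simp [hs]
      rw [this, Complex.cpow_add _ _ hp0, Complex.ofReal_cpow (by positivity),
        Complex.cpow_def_of_ne_zero hp0 (t * Complex.I), ← Complex.natCast_log, mul_assoc,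
        Complex.ofReal_natCast]
    rw [hpow, ← Complex.re_ofReal_mul]
    congr 1
    ring
  have hsx : 1 < s.re := hx1
  let y : Nat.Primes → ℝ := fun p ↦ (u * -Complex.log (1 - a p * (p : ℂ) ^ (-s))).re
  have hysum : HasSum y (u * logEulerProduct a s).re :=
    Complex.hasSum_re ((summable_log_one_sub_prime haprime hsx).hasSum.mul_left u)
  have hy (p : Nat.Primes) : (u * (a p * (p : ℂ) ^ (-s))).re - (p : ℝ) ^ (-2 : ℝ) ≤ y p := by
    have h1 := norm_log_one_sub_prime_sub_le haprime p hsx.le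
    have h2 := (abs_le.1 ((Complex.abs_re_le_norm (u * (-Complex.log (1 - a p * (p : ℂ) ^ (-s)) -
      a p * (p : ℂ) ^ (-s)))).trans_eq (by rw [norm_mul, hu, one_mul]))).1
    rw [mul_sub, Complex.sub_re] at h2
    linarith
  have hzlow (p : Nat.Primes) : -(p : ℝ) ^ (-x) ≤ (u * (a p * (p : ℂ) ^ (-s))).re := by
    have := (abs_le.1 (Complex.abs_re_le_norm (u * (a p * (p : ℂ) ^ (-s))))).1
    rwa [norm_mul, hu, one_mul, norm_mul_prime_cpow haprime] at this
  have htot := (hysum.add hw.hasSum).add hsq.hasSum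
  have hle := sum_le_hasSum F (fun p _ ↦ by linarith [hy p, hzlow p]) htot
  have hlow : ∑ p ∈ F, ((u * (a p * (p : ℂ) ^ (-s))).re + (p : ℝ) ^ (-x)) ≤
      ∑ p ∈ F, (y p + (p : ℝ) ^ (-x) + (p : ℝ) ^ (-2 : ℝ)) :=
    Finset.sum_le_sum fun p _ ↦ by linarith [hy p]
  rw [Finset.sum_add_distrib, Finset.sum_congr rfl fun p _ ↦ hz p] at hlow
  linarith

end

lemma arg_exp_eq_of_im_eq {z : ℂ} {θ : ℝ} (hθ : θ ∈ Set.Ioc (-π) π) (k : ℤ)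
    (h : z.im = θ + k * (2 * π)) : (Complex.exp z).arg = θ := by
  rw [Complex.arg_exp, toIocMod_eq_iff]
  exact ⟨⟨hθ.1, by linarith [hθ.2]⟩, k, by simpa using h⟩

/-- Let `σ₀ > 1`, `θ ∈ (-π, π]` and `n ∈ ℕ`. Then there is `ρ ∈ (1, σ₀)` and `n`
pairwise distinct points `s₁, …, s_n`, each with `ρ < Re s_j < σ₀`, such that
`Arg(S_a(s_j)) = θ` for every `j`. -/
theorem exists_strip_arg_eq_at_n_points
    (a : ℕ → ℂ) (ha1 : a 1 = 1)
    (hmul : ∀ m n : ℕ, m ≠ 0 → n ≠ 0 → a (m * n) = a m * a n)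
    (haprime : ∀ p : ℕ, p.Prime → ‖a p‖ = 1)
    (σ₀ : ℝ) (hσ₀ : 1 < σ₀) (θ : ℝ) (hθ : θ ∈ Set.Ioc (-π) π) (n : ℕ) :
    ∃ ρ : ℝ, 1 < ρ ∧ ρ < σ₀ ∧
      ∃ s : Fin n → ℂ, Function.Injective s ∧
        ∀ j : Fin n, ρ < (s j).re ∧ (s j).re < σ₀ ∧ (LSeries a (s j)).arg = θ := by
  have hnorm := norm_eq_one_of_mul_of_prime ha1 hmul haprime
  obtain ⟨x, hx1, hxσ, hx⟩ := exists_vertical_line_le_re_mul_logEulerProduct ha1 hmul haprime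
    (π + n * (2 * π)) hσ₀
  obtain ⟨t₁, ht₁⟩ := hx Complex.I (by simp)
  obtain ⟨t₂, ht₂⟩ := hx (-Complex.I) (by simp)
  simp only [neg_mul, Complex.neg_re, Complex.I_mul_re, neg_neg] at ht₁ ht₂
  have hcont : Continuous fun t : ℝ ↦ (logEulerProduct a ⟨x, t⟩).im :=
    Complex.continuous_im.comp (continuous_logEulerProduct_vertical haprime hx1)
  have hval (j : Fin n) : ∃ t : ℝ, (logEulerProduct a ⟨x, t⟩).im = θ + (j : ℕ) * (2 * π) := by
    have hj : ((j : ℕ) : ℝ) ≤ n := by exact_mod_cast j.2.le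
    have hj' : ((j : ℕ) : ℝ) * (2 * π) ≤ n * (2 * π) := by gcongr
    have hj0 : 0 ≤ ((j : ℕ) : ℝ) * (2 * π) := by positivity
    exact mem_range_of_exists_le_of_exists_ge hcont ⟨t₁, by linarith [hθ.1]⟩
      ⟨t₂, by linarith [hθ.2]⟩
  choose t ht using hval
  refine ⟨(1 + x) / 2, by linarith, by linarith, fun j ↦ ⟨x, t j⟩, fun i j hij ↦ ?_,
    fun j ↦ ⟨by dsimp only; linarith, hxσ, ?_⟩⟩
  · have h : t i = t j := congrArg Complex.im hij
    have h2 := ht i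
    rw [h, ht j, add_right_inj, mul_left_inj' (by positivity), Nat.cast_inj] at h2
    exact Fin.ext h2.symm
  · rw [← exp_logEulerProduct ha1 hmul hnorm (s := ⟨x, t j⟩) hx1]
    exact arg_exp_eq_of_im_eq hθ j (by simpa using ht j)
end

section
/- Let σ₀ > 1 and θ ∈ (-π, π]. Then the set {s ∈ ℂ : 1 < Re s < σ₀ and Arg(S_a(s)) = θ} is infinite. -/
open Real
open Filter Topology ComplexConjugate

/-- `f` is continuous and its averages over `[0, T]` tend to `m` as `T → ∞`. -/
def HasMean (f : ℝ → ℂ) (m : ℂ) : Prop :=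
  Continuous f ∧ Tendsto (fun T : ℝ => (T : ℂ)⁻¹ * ∫ t in (0 : ℝ)..T, f t) atTop (𝓝 m)

namespace HasMean

lemma add {f g : ℝ → ℂ} {m n : ℂ} (hf : HasMean f m) (hg : HasMean g n) :
    HasMean (fun t => f t + g t) (m + n) := by
  refine ⟨hf.1.add hg.1, (hf.2.add hg.2).congr fun T => ?_⟩
  rw [intervalIntegral.integral_add (hf.1.intervalIntegrable _ _) (hg.1.intervalIntegrable _ _)]
  ring

lemma const_mul {f : ℝ → ℂ} {m : ℂ} (c : ℂ) (hf : HasMean f m) :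
    HasMean (fun t => c * f t) (c * m) := by
  refine ⟨continuous_const.mul hf.1, (hf.2.const_mul c).congr fun T => ?_⟩
  rw [intervalIntegral.integral_const_mul]
  ring

lemma zero : HasMean (fun _ => 0) 0 :=
  ⟨continuous_const, by simp⟩

lemma sum {ι : Type*} (s : Finset ι) {f : ι → ℝ → ℂ} {m : ι → ℂ}
    (h : ∀ i ∈ s, HasMean (f i) (m i)) :
    HasMean (fun t => ∑ i ∈ s, f i t) (∑ i ∈ s, m i) := by
  classical
  induction s using Finset.induction_on with
  | empty => simpa using zero
  | insert i s hi ih =>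
    simp only [Finset.sum_insert hi]
    exact (h i (by simp)).add (ih fun j hj => h j (by simp [hj]))

lemma exp (ω : ℝ) :
    HasMean (fun t => Complex.exp (ω * t * Complex.I)) (if ω = 0 then 1 else 0) := by
  refine ⟨by fun_prop, ?_⟩
  split_ifs with h
  · refine tendsto_const_nhds.congr' ?_
    filter_upwards [eventually_gt_atTop 0] with T hT
    have : (T : ℂ) ≠ 0 := by exact_mod_cast hT.ne'
    simp [h, this]
  · have hc : (ω : ℂ) * Complex.I ≠ 0 := by simp [h]
    have hbound : ∀ T : ℝ, ‖∫ t in (0 : ℝ)..T, Complex.exp (ω * t * Complex.I)‖ ≤ 2 / |ω| := by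
      intro T
      have : ∀ t : ℝ, (ω : ℂ) * t * Complex.I = ω * Complex.I * t := fun t => by ring
      simp only [this]
      rw [integral_exp_mul_complex hc, norm_div]
      have h1 : ‖Complex.exp (ω * Complex.I * T)‖ = 1 := by
        rw [← this]
        exact_mod_cast Complex.norm_exp_ofReal_mul_I (ω * T)
      have h2 : ‖(ω : ℂ) * Complex.I‖ = |ω| := by simp
      rw [h2]
      gcongr
      refine (norm_sub_le _ _).trans ?_
      rw [h1]
      norm_num
    refine squeeze_zero_norm' (a := fun T : ℝ => T⁻¹ * (2 / |ω|)) ?_ ?_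
    · filter_upwards [eventually_gt_atTop 0] with T hT
      rw [norm_mul, norm_inv, Complex.norm_real, Real.norm_of_nonneg hT.le]
      exact mul_le_mul_of_nonneg_left (hbound T) (inv_nonneg.2 hT.le)
    · simpa using tendsto_inv_atTop_zero.mul_const (2 / |ω|)

lemma re_nonpos {f : ℝ → ℂ} {m : ℂ} (hf : HasMean f m) (h : ∀ t, (f t).re ≤ 0) : m.re ≤ 0 := by
  refine le_of_tendsto ((Complex.continuous_re.tendsto m).comp hf.2) ?_
  filter_upwards [eventually_gt_atTop 0] with T hT
  have h1 : (∫ t in (0 : ℝ)..T, f t).re = ∫ t in (0 : ℝ)..T, (f t).re :=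
    (Complex.reCLM.intervalIntegral_comp_comm (hf.1.intervalIntegrable 0 T)).symm
  have h2 : ∫ t in (0 : ℝ)..T, (f t).re ≤ 0 := by
    rw [← neg_nonneg, ← intervalIntegral.integral_neg]
    exact intervalIntegral.integral_nonneg hT.le fun t _ => by linarith [h t]
  rw [Function.comp_apply, ← Complex.ofReal_inv, Complex.re_ofReal_mul, h1]
  exact mul_nonpos_of_nonneg_of_nonpos (inv_nonneg.2 hT.le) h2

end HasMean

/-- Mean of the product of one family of characters with the conjugate of another, for frequencies
whose sums over distinct multisets are distinct. -/
lemma hasMean_prod_mul_conj_prod {ι : Type*} (ω : ι → ℝ)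
    (hω : Function.Injective fun A : Multiset ι => (A.map ω).sum) (u : ι → ℂ)
    (hu : ∀ i, ‖u i‖ = 1) (A B : Multiset ι) [Decidable (A = B)] :
    HasMean (fun t => (A.map fun i => u i * Complex.exp (ω i * t * Complex.I)).prod *
      conj ((B.map fun i => u i * Complex.exp (ω i * t * Complex.I)).prod))
      (if A = B then 1 else 0) := by
  have key : ∀ (A : Multiset ι) (t : ℝ),
      (A.map fun i => u i * Complex.exp (ω i * t * Complex.I)).prod =
        (A.map u).prod * Complex.exp (((A.map ω).sum : ℝ) * t * Complex.I) := by
    intro A t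
    induction A using Multiset.induction_on with
    | empty => simp
    | cons i A ih =>
      simp only [Multiset.map_cons, Multiset.prod_cons, Multiset.sum_cons, ih]
      push_cast
      rw [add_mul, add_mul, Complex.exp_add]
      ring
  have hnorm : ∀ A : Multiset ι, ‖(A.map u).prod‖ = 1 := by
    intro A
    induction A using Multiset.induction_on with
    | empty => simp
    | cons i A ih => simp [ih, hu]
  have h := (HasMean.exp ((A.map ω).sum - (B.map ω).sum)).const_mul
    ((A.map u).prod * conj (B.map u).prod)
  have hm : (A.map u).prod * conj (B.map u).prod *
      (if (A.map ω).sum - (B.map ω).sum = 0 then 1 else 0) = if A = B then 1 else 0 := by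
    by_cases hAB : A = B
    · simp [hAB, Complex.mul_conj, Complex.normSq_eq_norm_sq, hnorm]
    · have : (A.map ω).sum - (B.map ω).sum ≠ 0 := fun h0 => hAB (hω (sub_eq_zero.1 h0))
      simp [hAB, this]
  rw [hm] at h
  convert h using 2 with t
  rw [key A, key B, map_mul, ← Complex.exp_conj]
  simp only [map_mul, Complex.conj_ofReal, Complex.conj_I]
  rw [mul_mul_mul_comm, ← Complex.exp_add]
  push_cast
  ring_nf

/-- For frequencies whose sums over distinct multisets are distinct, a trigonometric
polynomial takes values whose real part is at least any number below half the sum of its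
coefficients. -/
lemma exists_le_re_sum_of_injective {ι : Type*} (ω : ι → ℝ)
    (hω : Function.Injective fun A : Multiset ι => (A.map ω).sum) (u : ι → ℂ)
    (hu : ∀ i, ‖u i‖ = 1) (S : Finset ι) (r : ι → ℝ) {c : ℝ} (hc : c < (∑ i ∈ S, r i) / 2) :
    ∃ t : ℝ, c ≤ (∑ i ∈ S, (r i : ℂ) * (u i * Complex.exp (ω i * t * Complex.I))).re := by
  classical
  by_contra! hlt
  set v : ι → ℝ → ℂ := fun i t => u i * Complex.exp (ω i * t * Complex.I) with hv
  set W : ℝ → ℂ := fun t => (∏ i ∈ S, (1 + v i t)) * conj (∏ i ∈ S, (1 + v i t)) with hW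
  have hWsum : ∀ t, W t = ∑ A ∈ S.powerset, ∑ B ∈ S.powerset,
      (A.val.map fun i => v i t).prod * conj ((B.val.map fun i => v i t).prod) := by
    intro t
    simp only [hW, Finset.prod_one_add, map_sum, Finset.sum_mul_sum]
    rfl
  have hmean : HasMean W (2 ^ S.card) := by
    have h := HasMean.sum S.powerset fun A _ => HasMean.sum S.powerset fun B _ =>
      hasMean_prod_mul_conj_prod ω hω u hu A.val B.val
    simp only [Finset.val_inj, Finset.sum_ite_eq] at h
    convert h using 2 with t
    · rw [hWsum]
    · rw [Finset.sum_congr rfl fun A hA => if_pos hA]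
      simp
  have hmeanv : ∀ q ∈ S, HasMean (fun t => v q t * W t) (2 ^ S.card / 2) := by
    intro q hq
    have h := HasMean.sum S.powerset fun A _ => HasMean.sum S.powerset fun B _ =>
      hasMean_prod_mul_conj_prod ω hω u hu (q ::ₘ A.val) B.val
    have hcount : ∀ A ∈ S.powerset, (∑ B ∈ S.powerset, if q ::ₘ A.val = B.val then (1 : ℂ) else 0)
        = if q ∉ A then 1 else 0 := by
      intro A hA
      by_cases hqA : q ∈ A
      · rw [if_neg (by simpa using hqA)]
        refine Finset.sum_eq_zero fun B _ => if_neg fun hB => ?_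
        have := B.nodup
        rw [← hB, Multiset.nodup_cons] at this
        exact this.1 hqA
      · rw [if_pos hqA, ← Finset.insert_val_of_notMem hqA]
        simp only [Finset.val_inj, Finset.sum_ite_eq]
        refine if_pos (Finset.mem_powerset.2 (Finset.insert_subset hq (Finset.mem_powerset.1 hA)))
    have hfilter : S.powerset.filter (fun A => q ∉ A) = (S.erase q).powerset := by
      ext A
      simp [Finset.subset_erase]
    rw [Finset.sum_congr rfl hcount, ← Finset.sum_filter, hfilter] at h
    convert h using 2 with t
    · rw [hWsum, Finset.mul_sum]
      refine Finset.sum_congr rfl fun A _ => ?_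
      rw [Finset.mul_sum]
      refine Finset.sum_congr rfl fun B _ => ?_
      simp only [hv, Multiset.map_cons, Multiset.prod_cons, mul_assoc]
    · rw [← Finset.card_erase_add_one hq, pow_succ]
      simp
  have h := ((HasMean.sum S fun q hq => (hmeanv q hq).const_mul (r q)).add
    (hmean.const_mul (-(c : ℂ)))).re_nonpos (by
      intro t
      have : (∑ i ∈ S, (r i : ℂ) * (v i t * W t)) + -(c : ℂ) * W t =
          ((Complex.normSq (∏ i ∈ S, (1 + v i t)) : ℝ) : ℂ) *
            (∑ i ∈ S, (r i : ℂ) * v i t - (c : ℂ)) := by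
        rw [← Complex.mul_conj, mul_sub, Finset.mul_sum]
        simp only [hW]
        rw [sub_eq_add_neg]
        congr 1
        · exact Finset.sum_congr rfl fun i _ => by ring
        · ring
      rw [this, Complex.re_ofReal_mul, Complex.sub_re, Complex.ofReal_re]
      exact mul_nonpos_of_nonneg_of_nonpos (Complex.normSq_nonneg _) (by linarith [hlt t]))
  have h2 : (∑ i ∈ S, (r i : ℂ) * (2 ^ S.card / 2)) + -(c : ℂ) * 2 ^ S.card =
      (((∑ i ∈ S, r i) / 2 - c) * 2 ^ S.card : ℝ) := by
    push_cast
    rw [← Finset.sum_mul]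
    ring
  rw [h2, Complex.ofReal_re] at h
  have : 0 < ((∑ i ∈ S, r i) / 2 - c) * 2 ^ S.card := mul_pos (by linarith) (by positivity)
  linarith

/-- Unique factorization, as a statement about logarithms of primes. -/
lemma Nat.Primes.injective_sum_neg_log :
    Function.Injective fun A : Multiset Nat.Primes =>
      (A.map fun p : Nat.Primes => -Real.log (p : ℕ)).sum := by
  have key : ∀ A : Multiset Nat.Primes, (A.map fun p : Nat.Primes => -Real.log (p : ℕ)).sum =
      -Real.log ((PrimeMultiset.prod A : ℕ+) : ℕ) := by
    intro A
    induction A using Multiset.induction_on with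
    | empty =>
      rw [show PrimeMultiset.prod (0 : Multiset Nat.Primes) = 1 from PrimeMultiset.prod_zero]
      simp
    | cons p A ih =>
      have hprod : PrimeMultiset.prod (p ::ₘ A) = (p : ℕ+) * PrimeMultiset.prod A :=
        (PrimeMultiset.prod_add (PrimeMultiset.ofPrime p) A).trans
          (by rw [PrimeMultiset.prod_ofPrime])
      rw [Multiset.map_cons, Multiset.sum_cons, ih, hprod, PNat.mul_coe, Nat.cast_mul,
        Real.log_mul (by simp) (by simp), neg_add]
      rfl
  intro A B hAB
  simp only [key, neg_inj] at hAB
  have h := Real.log_injOn_pos (by simp) (by simp) hAB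
  have h' : PrimeMultiset.prod A = PrimeMultiset.prod B := PNat.coe_injective (by exact_mod_cast h)
  exact PNat.factorMultisetEquiv.symm.injective h'

/-- The logarithm of the Euler product with local factors `(1 - a p * p ^ (-s))⁻¹`. -/
noncomputable def logEuler (a : ℕ → ℂ) (s : ℂ) : ℂ :=
  ∑' p : Nat.Primes, -Complex.log (1 - LSeries.term a s p)

section

variable {a : ℕ → ℂ}

lemma norm_eq_one_of_completely_multiplicative (ha1 : a 1 = 1)
    (hmul : ∀ m n : ℕ, m ≠ 0 → n ≠ 0 → a (m * n) = a m * a n)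
    (haprime : ∀ p : ℕ, p.Prime → ‖a p‖ = 1) {n : ℕ} (hn : n ≠ 0) : ‖a n‖ = 1 := by
  induction n using induction_on_primes with
  | zero => exact absurd rfl hn
  | one => simp [ha1]
  | prime_mul p n hp ih =>
    have hn0 : n ≠ 0 := right_ne_zero_of_mul hn
    rw [hmul p n hp.ne_zero hn0, norm_mul, haprime p hp, ih hn0, one_mul]

lemma exp_logEuler (ha1 : a 1 = 1)
    (hmul : ∀ m n : ℕ, m ≠ 0 → n ≠ 0 → a (m * n) = a m * a n)
    (haprime : ∀ p : ℕ, p.Prime → ‖a p‖ = 1) {s : ℂ} (hs : 1 < s.re) :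
    Complex.exp (logEuler a s) = LSeries a s := by
  let f : ℕ →*₀ ℂ :=
    { toFun := LSeries.term a s
      map_zero' := by simp
      map_one' := by simp [ha1]
      map_mul' := by
        intro m n
        rcases eq_or_ne m 0 with rfl | hm
        · simp
        rcases eq_or_ne n 0 with rfl | hn
        · simp
        simp only [LSeries.term_of_ne_zero hm, LSeries.term_of_ne_zero hn,
          LSeries.term_of_ne_zero (mul_ne_zero hm hn), hmul m n hm hn, Nat.cast_mul,
          Complex.natCast_mul_natCast_cpow]
        exact mul_div_mul_comm _ _ _ _ }
  have hsum : LSeriesSummable a s := LSeriesSummable_of_bounded_of_one_lt_re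
    (fun n hn => (norm_eq_one_of_completely_multiplicative ha1 hmul haprime hn).le) hs
  exact EulerProduct.exp_tsum_primes_log_eq_tsum (f := f) hsum.norm

lemma norm_term_prime (haprime : ∀ p : ℕ, p.Prime → ‖a p‖ = 1) (s : ℂ) (p : Nat.Primes) :
    ‖LSeries.term a s p‖ = (p : ℝ) ^ (-s.re) := by
  rw [LSeries.norm_term_eq, if_neg p.2.ne_zero, haprime p p.2, Real.rpow_neg (by positivity),
    one_div]

lemma prime_rpow_neg_le_inv {x : ℝ} (hx : 1 ≤ x) (p : Nat.Primes) :
    (p : ℝ) ^ (-x) ≤ (p : ℝ)⁻¹ := by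
  rw [← Real.rpow_neg_one]
  exact Real.rpow_le_rpow_of_exponent_le (by exact_mod_cast p.2.one_le) (by linarith)

lemma prime_inv_le_half (p : Nat.Primes) : (p : ℝ)⁻¹ ≤ 1 / 2 := by
  rw [one_div]
  exact inv_anti₀ (by norm_num) (by exact_mod_cast p.2.two_le)

lemma norm_term_prime_le_half (haprime : ∀ p : ℕ, p.Prime → ‖a p‖ = 1) {s : ℂ} (hs : 1 ≤ s.re)
    (p : Nat.Primes) : ‖LSeries.term a s p‖ ≤ 1 / 2 := by
  rw [norm_term_prime haprime]
  exact (prime_rpow_neg_le_inv hs p).trans (prime_inv_le_half p)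

lemma norm_neg_log_one_sub_sub_self_le {z : ℂ} (hz : ‖z‖ ≤ 1 / 2) :
    ‖-Complex.log (1 - z) - z‖ ≤ ‖z‖ ^ 2 := by
  have h := Complex.norm_log_one_add_sub_self_le (z := -z) (by rw [norm_neg]; linarith)
  rw [norm_neg, ← sub_eq_add_neg] at h
  have h' : ‖-Complex.log (1 - z) - z‖ = ‖Complex.log (1 - z) - -z‖ := by
    rw [← norm_neg]
    congr 1
    ring
  have hinv : (1 - ‖z‖)⁻¹ ≤ 2 := by
    rw [inv_le_comm₀ (by linarith) (by norm_num)]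
    linarith
  rw [h']
  nlinarith [sq_nonneg ‖z‖]

lemma norm_neg_log_one_sub_le {z : ℂ} (hz : ‖z‖ ≤ 1 / 2) :
    ‖-Complex.log (1 - z)‖ ≤ 3 / 2 * ‖z‖ := by
  have h := Complex.norm_log_one_add_half_le_self (z := -z) (by rwa [norm_neg])
  rwa [norm_neg, ← sub_eq_add_neg, ← norm_neg] at h

lemma summable_prime_rpow_neg {x : ℝ} (hx : 1 < x) :
    Summable fun p : Nat.Primes => (p : ℝ) ^ (-x) :=
  Nat.Primes.summable_rpow.2 (by linarith)

lemma summable_prime_inv_sq : Summable fun p : Nat.Primes => ((p : ℝ)⁻¹) ^ 2 := by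
  refine (Nat.Primes.summable_rpow.2 (by norm_num : (-2 : ℝ) < -1)).congr fun p => ?_
  rw [Real.rpow_neg (by positivity), inv_pow]
  norm_cast

lemma continuous_logEuler_vertical (haprime : ∀ p : ℕ, p.Prime → ‖a p‖ = 1) {x : ℝ}
    (hx : 1 < x) : Continuous fun t : ℝ => logEuler a (x + t * Complex.I) := by
  have hre : ∀ t : ℝ, ((x : ℂ) + t * Complex.I).re = x := fun t => by simp
  refine continuous_tsum (u := fun p : Nat.Primes => 3 / 2 * (p : ℝ) ^ (-x)) (fun p => ?_)
    ((summable_prime_rpow_neg hx).mul_left _) (fun p t => ?_)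
  · refine (Continuous.clog ?_ fun t => ?_).neg
    · simp only [LSeries.term_of_ne_zero p.2.ne_zero]
      have hp : (p : ℂ) ≠ 0 := by exact_mod_cast p.2.ne_zero
      refine continuous_const.sub (continuous_const.div ?_ fun t => by simp [hp])
      exact Continuous.const_cpow (by fun_prop) (Or.inl hp)
    · rw [sub_eq_add_neg]
      refine Complex.mem_slitPlane_of_norm_lt_one ?_
      rw [norm_neg]
      have := norm_term_prime_le_half haprime (s := x + t * Complex.I) (by rw [hre]; exact hx.le) p
      linarith
  · refine (norm_neg_log_one_sub_le (norm_term_prime_le_half haprime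
      (by rw [hre]; exact hx.le) p)).trans ?_
    rw [norm_term_prime haprime, hre]

lemma norm_logEuler_sub_sum_le (haprime : ∀ p : ℕ, p.Prime → ‖a p‖ = 1) {s : ℂ}
    (hs : 1 < s.re) (S : Finset Nat.Primes) :
    ‖logEuler a s - ∑ p ∈ S, LSeries.term a s p‖ ≤
      (∑' p : Nat.Primes, ((p : ℝ)⁻¹) ^ 2) + ∑' p : { p // p ∉ S }, ((p : Nat.Primes) : ℝ) ^ (-s.re)
      := by
  have hhalf := norm_term_prime_le_half haprime hs.le
  have hsz : Summable fun p : Nat.Primes => LSeries.term a s p :=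
    Summable.of_norm (by simpa only [norm_term_prime haprime] using summable_prime_rpow_neg hs)
  have hsl : Summable fun p : Nat.Primes => -Complex.log (1 - LSeries.term a s p) :=
    Summable.of_norm_bounded ((summable_prime_rpow_neg hs).mul_left (3 / 2)) fun p => by
      simpa only [norm_term_prime haprime] using norm_neg_log_one_sub_le (hhalf p)
  have hsplit : logEuler a s - ∑ p ∈ S, LSeries.term a s p =
      (∑' p : Nat.Primes, (-Complex.log (1 - LSeries.term a s p) - LSeries.term a s p)) +
        ∑' p : { p // p ∉ S }, LSeries.term a s (p : Nat.Primes) := by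
    have h := hsz.sum_add_tsum_compl (s := S)
    rw [hsl.tsum_sub hsz, ← h, logEuler]
    have : (∑' p : { p // p ∉ S }, LSeries.term a s (p : Nat.Primes)) =
      ∑' p : ((S : Set Nat.Primes)ᶜ : Set Nat.Primes), LSeries.term a s (p : Nat.Primes) := rfl
    rw [this]
    ring
  rw [hsplit]
  refine (norm_add_le _ _).trans (add_le_add ?_ ?_)
  · refine tsum_of_norm_bounded summable_prime_inv_sq.hasSum fun p => ?_
    refine (norm_neg_log_one_sub_sub_self_le (hhalf p)).trans ?_
    rw [norm_term_prime haprime]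
    gcongr
    exact prime_rpow_neg_le_inv hs.le p
  · refine tsum_of_norm_bounded ((summable_prime_rpow_neg hs).comp_injective
      Subtype.val_injective).hasSum fun p => ?_
    rw [norm_term_prime haprime]
    rfl

lemma term_prime_vertical (x t : ℝ) (p : Nat.Primes) :
    LSeries.term a (x + t * Complex.I) p =
      ((p : ℝ) ^ (-x) : ℝ) * (a p * Complex.exp ((-Real.log (p : ℕ) : ℝ) * t * Complex.I)) := by
  have hp : (p : ℂ) ≠ 0 := by exact_mod_cast p.2.ne_zero
  rw [LSeries.term_of_ne_zero p.2.ne_zero, div_eq_mul_inv, ← Complex.cpow_neg, neg_add,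
    Complex.cpow_add _ _ hp, Complex.ofReal_cpow (by positivity), Complex.cpow_def_of_ne_zero hp
    (-(t * Complex.I))]
  push_cast
  ring_nf

/-- On a vertical line on which `∑ p ^ (-x)` is large enough, `e * logEuler` attains real parts
at least `K`, for every unimodular `e`. -/
lemma exists_le_re_mul_logEuler (haprime : ∀ p : ℕ, p.Prime → ‖a p‖ = 1) {x : ℝ} (hx : 1 < x)
    {e : ℂ} (he : ‖e‖ = 1) {K : ℝ} {S₀ : Finset Nat.Primes}
    (hS₀ : 2 * (K + 1 + ∑' p : Nat.Primes, ((p : ℝ)⁻¹) ^ 2) < ∑ p ∈ S₀, (p : ℝ) ^ (-x)) :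
    ∃ t : ℝ, K ≤ (e * logEuler a (x + t * Complex.I)).re := by
  set C : ℝ := ∑' p : Nat.Primes, ((p : ℝ)⁻¹) ^ 2
  obtain ⟨S, hS, htail⟩ : ∃ S : Finset Nat.Primes, S₀ ⊆ S ∧
      ∑' p : { p // p ∉ S }, ((p : Nat.Primes) : ℝ) ^ (-x) < 1 :=
    ((eventually_ge_atTop S₀).and ((tendsto_tsum_compl_atTop_zero
      fun p : Nat.Primes => (p : ℝ) ^ (-x)).eventually_lt_const one_pos)).exists
  have hle : ∑ p ∈ S₀, (p : ℝ) ^ (-x) ≤ ∑ p ∈ S, (p : ℝ) ^ (-x) :=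
    Finset.sum_le_sum_of_subset_of_nonneg hS fun p _ _ => by positivity
  obtain ⟨t, ht⟩ := exists_le_re_sum_of_injective _ Nat.Primes.injective_sum_neg_log
    (fun p : Nat.Primes => e * a p) (fun p => by rw [norm_mul, he, haprime p p.2, one_mul]) S
    (fun p : Nat.Primes => (p : ℝ) ^ (-x)) (c := K + 1 + C) (by linarith)
  refine ⟨t, ?_⟩
  have hsum : ∑ p ∈ S, (((p : ℝ) ^ (-x) : ℝ) : ℂ) *
      (e * a p * Complex.exp ((-Real.log (p : ℕ) : ℝ) * t * Complex.I)) =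
      e * ∑ p ∈ S, LSeries.term a (x + t * Complex.I) p := by
    rw [Finset.mul_sum]
    refine Finset.sum_congr rfl fun p _ => ?_
    rw [term_prime_vertical]
    ring
  rw [hsum] at ht
  have hre : ((x : ℂ) + t * Complex.I).re = x := by simp
  have h := norm_logEuler_sub_sum_le haprime (s := x + t * Complex.I) (by rwa [hre]) S
  rw [hre] at h
  have h2 := (abs_le.1 (Complex.abs_re_le_norm
    (e * (logEuler a (x + t * Complex.I) - ∑ p ∈ S, LSeries.term a (x + t * Complex.I) p)))).1
  rw [norm_mul, he, one_mul, mul_sub, Complex.sub_re] at h2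
  linarith

/-- On a vertical line on which `∑ p ^ (-x)` is large enough, every argument is attained. -/
lemma exists_arg_LSeries_eq (ha1 : a 1 = 1)
    (hmul : ∀ m n : ℕ, m ≠ 0 → n ≠ 0 → a (m * n) = a m * a n)
    (haprime : ∀ p : ℕ, p.Prime → ‖a p‖ = 1) {x : ℝ} (hx : 1 < x) {S₀ : Finset Nat.Primes}
    (hS₀ : 2 * (π + 1 + ∑' p : Nat.Primes, ((p : ℝ)⁻¹) ^ 2) < ∑ p ∈ S₀, (p : ℝ) ^ (-x))
    {θ : ℝ} (hθ : θ ∈ Set.Ioc (-π) π) :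
    ∃ t : ℝ, (LSeries a (x + t * Complex.I)).arg = θ := by
  obtain ⟨t₁, h₁⟩ := exists_le_re_mul_logEuler haprime hx (e := Complex.I) (by simp) hS₀
  obtain ⟨t₂, h₂⟩ := exists_le_re_mul_logEuler haprime hx (e := -Complex.I) (by simp) hS₀
  rw [Complex.I_mul_re] at h₁
  rw [neg_mul, Complex.neg_re, Complex.I_mul_re, neg_neg] at h₂
  obtain ⟨t, ht⟩ := mem_range_of_exists_le_of_exists_ge
    (Complex.continuous_im.comp (continuous_logEuler_vertical haprime hx)) (c := θ)
    ⟨t₁, by simp only [Function.comp_apply]; linarith [hθ.1]⟩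
    ⟨t₂, by simp only [Function.comp_apply]; linarith [hθ.2]⟩
  refine ⟨t, ?_⟩
  rw [← exp_logEuler ha1 hmul haprime (by simpa using hx), Complex.arg_exp]
  simp only [Function.comp_apply] at ht
  rw [ht, toIocMod_eq_self]
  exact ⟨hθ.1, by linarith [hθ.2]⟩

end

lemma exists_finset_primes_lt_sum_rpow (K : ℝ) :
    ∃ S : Finset Nat.Primes, ∀ᶠ x in 𝓝 (1 : ℝ), K < ∑ p ∈ S, (p : ℝ) ^ (-x) := by
  obtain ⟨S, hS⟩ : ∃ S : Finset Nat.Primes, K < ∑ p ∈ S, 1 / (p : ℝ) := by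
    by_contra! h
    exact Nat.Primes.not_summable_one_div (summable_of_sum_le (fun p => by positivity) h)
  refine ⟨S, ?_⟩
  have hcont : Continuous fun x : ℝ => ∑ p ∈ S, (p : ℝ) ^ (-x) :=
    continuous_finsetSum _ fun p _ => Continuous.rpow continuous_const continuous_neg
      fun _ => Or.inl (by exact_mod_cast p.2.ne_zero)
  refine (hcont.tendsto 1).eventually_const_lt ?_
  simpa only [Real.rpow_neg_one, one_div] using hS

/-- Let `σ₀ > 1` and `θ ∈ (-π, π]`. The set
`{s : 1 < Re s < σ₀ ∧ Arg(S_a(s)) = θ}` is infinite. -/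
theorem arg_LSeries_eq_infinitely_often_in_strip
    (a : ℕ → ℂ) (ha1 : a 1 = 1)
    (hmul : ∀ m n : ℕ, m ≠ 0 → n ≠ 0 → a (m * n) = a m * a n)
    (haprime : ∀ p : ℕ, p.Prime → ‖a p‖ = 1)
    (σ₀ : ℝ) (hσ₀ : 1 < σ₀) (θ : ℝ) (hθ : θ ∈ Set.Ioc (-π) π) :
    {s : ℂ | 1 < s.re ∧ s.re < σ₀ ∧ (LSeries a s).arg = θ}.Infinite := by
  obtain ⟨S, hS⟩ := exists_finset_primes_lt_sum_rpow
    (2 * (π + 1 + ∑' p : Nat.Primes, ((p : ℝ)⁻¹) ^ 2))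
  obtain ⟨σ₁, hσ₁, hsub⟩ := (mem_nhdsGT_iff_exists_Ioo_subset' hσ₀).1
    ((hS.filter_mono nhdsWithin_le_nhds).and (Ioo_mem_nhdsGT hσ₀))
  refine Set.Infinite.of_image Complex.re ((Set.Ioo_infinite hσ₁).mono fun x hx => ?_)
  obtain ⟨hlarge, hx1, hx2⟩ := hsub hx
  obtain ⟨t, ht⟩ := exists_arg_LSeries_eq ha1 hmul haprime hx1 hlarge hθ
  exact ⟨x + t * Complex.I, by simpa [ht] using ⟨hx1, hx2⟩, by simp⟩
end

section
/- Let σ₀ > 1 and n ∈ ℕ. Then there exists a relatively dense set T ⊆ ℝ (i.e., there is L > 0 such that every interval of length L in ℝ contains a point of T) with the following property: for every t ∈ T there exist a continuous function φ : (1, σ₀) → ℝ with ζ(σ + it) = |ζ(σ + it)|·e^{iφ(σ)} for all σ ∈ (1, σ₀), and points σ₁, σ₂ ∈ (1, σ₀) with φ(σ₁) - φ(σ₂) ≥ 2πn; that is, the parametrized curve σ ↦ ζ(σ + it), σ ∈ (1, σ₀), makes at least n turns around the origin. -/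
open Real

open MeasureTheory Filter Topology in
/-- `g` has mean value `c` over all intervals of length `L`, uniformly, as `L → ∞`. -/
def HasUniformMean (g : ℝ → ℂ) (c : ℂ) : Prop :=
  ∀ ε > 0, ∀ᶠ L : ℝ in atTop, ∀ x : ℝ, ‖(∫ t in x..x + L, g t) - L * c‖ ≤ ε * L

namespace HasUniformMean

open MeasureTheory Filter Topology

theorem const (c : ℂ) : HasUniformMean (fun _ ↦ c) c := by
  intro ε hε
  filter_upwards [eventually_ge_atTop 0] with L hL x
  simp only [intervalIntegral.integral_const, add_sub_cancel_left, Complex.real_smul, sub_self,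
    norm_zero]
  positivity

theorem add {g h : ℝ → ℂ} {c d : ℂ} (hg : HasUniformMean g c) (hh : HasUniformMean h d)
    (hgc : Continuous g) (hhc : Continuous h) :
    HasUniformMean (fun t ↦ g t + h t) (c + d) := by
  intro ε hε
  filter_upwards [hg (ε / 2) (half_pos hε), hh (ε / 2) (half_pos hε)] with L h₁ h₂ x
  rw [intervalIntegral.integral_add (hgc.intervalIntegrable _ _) (hhc.intervalIntegrable _ _),
    mul_add, add_sub_add_comm]
  linarith [norm_add_le_of_le (h₁ x) (h₂ x)]

theorem const_mul {g : ℝ → ℂ} {c : ℂ} (hg : HasUniformMean g c) (a : ℂ) :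
    HasUniformMean (fun t ↦ a * g t) (a * c) := by
  intro ε hε
  have ha : 0 < ‖a‖ + 1 := by positivity
  filter_upwards [hg (ε / (‖a‖ + 1)) (by positivity), eventually_ge_atTop 0] with L h hL x
  rw [intervalIntegral.integral_const_mul, mul_left_comm, ← mul_sub, norm_mul]
  calc ‖a‖ * _ ≤ (‖a‖ + 1) * (ε / (‖a‖ + 1) * L) := by gcongr; exacts [by linarith, h x]
    _ = ε * L := by field_simp

theorem cexp {b : ℝ} (hb : b ≠ 0) :
    HasUniformMean (fun t ↦ Complex.exp (b * Complex.I * t)) 0 := by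
  intro ε hε
  have hb' : 0 < |b| := abs_pos.mpr hb
  filter_upwards [eventually_ge_atTop (2 / |b| / ε)] with L hL x
  have hbI : (b : ℂ) * Complex.I ≠ 0 := by simp [hb]
  rw [integral_exp_mul_complex hbI, mul_zero, sub_zero, norm_div]
  have hn (y : ℝ) : ‖Complex.exp (b * Complex.I * y)‖ = 1 := by
    rw [← Complex.norm_exp_ofReal_mul_I (b * y)]
    push_cast
    ring_nf
  have h₂ := (norm_sub_le (Complex.exp (b * Complex.I * (x + L : ℝ)))
    (Complex.exp (b * Complex.I * x)))
  rw [hn, hn] at h₂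
  have h₃ : ‖(b : ℂ) * Complex.I‖ = |b| := by simp
  rw [h₃]
  calc _ ≤ 2 / |b| := by gcongr; linarith
    _ ≤ ε * L := by rwa [div_le_iff₀' hε] at hL

theorem of_approx {g : ℝ → ℂ} {c : ℂ} (hg : Continuous g)
    (H : ∀ ε > 0, ∃ h d, Continuous h ∧ HasUniformMean h d ∧
      (∀ t, ‖g t - h t‖ ≤ ε) ∧ ‖d - c‖ ≤ ε) :
    HasUniformMean g c := by
  intro ε hε
  obtain ⟨h, d, hc, hh, hgh, hdc⟩ := H (ε / 3) (by positivity)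
  filter_upwards [hh (ε / 3) (by positivity), eventually_ge_atTop 0] with L h₁ hL x
  have h₂ : ‖∫ t in x..x + L, (g t - h t)‖ ≤ ε / 3 * L := by
    simpa [abs_of_nonneg hL] using
      intervalIntegral.norm_integral_le_of_norm_le_const (a := x) (b := x + L)
        (fun t _ ↦ hgh t)
  have h₃ : ‖(L : ℂ) * (d - c)‖ ≤ L * (ε / 3) := by
    rw [norm_mul, Complex.norm_real, norm_of_nonneg hL]
    gcongr
  rw [intervalIntegral.integral_sub (hg.intervalIntegrable _ _) (hc.intervalIntegrable _ _)] at h₂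
  calc _ = ‖((∫ t in x..x + L, g t) - ∫ t in x..x + L, h t) +
          ((∫ t in x..x + L, h t) - L * d) + L * (d - c)‖ := by ring_nf
    _ ≤ ε / 3 * L + ε / 3 * L + L * (ε / 3) :=
        norm_add_le_of_le (norm_add_le_of_le h₂ (h₁ x)) h₃
    _ = ε * L := by ring

end HasUniformMean

namespace UnitAddTorus

open MeasureTheory Filter Topology AddCircle

variable {d : Type*} [Fintype d]

/-- The normalized Haar measure of the torus. -/
noncomputable abbrev haar (d : Type*) [Fintype d] : Measure (UnitAddTorus d) :=
  Measure.pi fun _ : d ↦ (haarAddCircle : Measure (AddCircle (1 : ℝ)))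

theorem integral_mFourier_eq_zero {n : d → ℤ} (hn : n ≠ 0) :
    ∫ x, mFourier n x ∂haar d = 0 := by
  obtain ⟨i, hi⟩ := Function.ne_iff.mp hn
  simp only [mFourier, ContinuousMap.coe_mk]
  rw [integral_fintype_prod_eq_prod (fun i x ↦ (fourier (n i) x : ℂ))]
  exact Finset.prod_eq_zero (Finset.mem_univ i) (integral_eq_zero_of_add_right_eq_neg
    (μ := haarAddCircle) (fourier_add_half_inv_index hi one_pos))

/-- The linear flow of slope `v` on the torus. -/
noncomputable def flow {d : Type*} (v : d → ℝ) (t : ℝ) : UnitAddTorus d :=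
  fun i ↦ ((t * v i : ℝ) : AddCircle (1 : ℝ))

theorem continuous_flow {d : Type*} (v : d → ℝ) : Continuous (flow v) :=
  continuous_pi fun i ↦ (AddCircle.continuous_mk' 1).comp (by fun_prop)

theorem mFourier_flow (v : d → ℝ) (n : d → ℤ) (t : ℝ) :
    mFourier n (flow v t) =
      Complex.exp ((2 * π * ∑ i, n i * v i : ℝ) * Complex.I * t) := by
  simp only [mFourier, ContinuousMap.coe_mk, flow, fourier_coe_apply]
  rw [← Complex.exp_sum]
  congr 1
  push_cast
  rw [Finset.mul_sum, Finset.sum_mul, Finset.sum_mul]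
  exact Finset.sum_congr rfl fun i _ ↦ by ring

/-- A linear flow with rationally independent frequencies is uniquely ergodic. -/
theorem hasUniformMean_flow {v : d → ℝ} (hv : ∀ n : d → ℤ, ∑ i, n i * v i = 0 → n = 0)
    (f : C(UnitAddTorus d, ℂ)) :
    HasUniformMean (fun t ↦ f (flow v t)) (∫ x, f x ∂haar d) := by
  have hint (f : C(UnitAddTorus d, ℂ)) : Integrable f (haar d) :=
    f.continuous.integrable_of_hasCompactSupport (HasCompactSupport.of_compactSpace _)
  have hcont (f : C(UnitAddTorus d, ℂ)) : Continuous fun t ↦ f (flow v t) :=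
    f.continuous.comp (continuous_flow v)
  have hspan : ∀ P ∈ Submodule.span ℂ (Set.range (mFourier (d := d))),
      HasUniformMean (fun t ↦ P (flow v t)) (∫ x, P x ∂haar d) := by
    intro P hP
    induction hP using Submodule.span_induction with
    | mem P hP =>
      obtain ⟨n, rfl⟩ := hP
      rcases eq_or_ne n 0 with rfl | hn
      · simpa [mFourier_zero] using HasUniformMean.const 1
      · rw [integral_mFourier_eq_zero hn]
        simp_rw [mFourier_flow]
        exact HasUniformMean.cexp (mul_ne_zero (by positivity) fun h ↦ hn (hv n h))
    | zero => simpa using HasUniformMean.const 0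
    | add P Q _ _ hP hQ =>
      simp only [ContinuousMap.add_apply]
      rw [integral_add (hint P) (hint Q)]
      exact hP.add hQ (hcont P) (hcont Q)
    | smul a P _ hP =>
      simp only [ContinuousMap.smul_apply, smul_eq_mul]
      rw [integral_const_mul]
      exact hP.const_mul a
  refine HasUniformMean.of_approx (hcont f) fun ε hε ↦ ?_
  have hf : f ∈ (Submodule.span ℂ (Set.range (mFourier (d := d)))).topologicalClosure := by
    rw [span_mFourier_closure_eq_top]
    trivial
  obtain ⟨P, hP, hfP⟩ := Metric.mem_closure_iff.mp hf ε hε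
  rw [dist_eq_norm] at hfP
  refine ⟨_, _, hcont P, hspan P hP, fun t ↦ ((f - P).norm_coe_le_norm _).trans hfP.le, ?_⟩
  rw [norm_sub_rev, ← integral_sub (hint f) (hint P)]
  simpa using norm_integral_le_of_norm_le_const (μ := haar d)
    (Eventually.of_forall fun x ↦ ((f - P).norm_coe_le_norm x).trans hfP.le)

/-- **Kronecker's theorem**: the times at which a linear flow with rationally independent
frequencies visits a nonempty open set are relatively dense. -/
theorem exists_flow_mem {v : d → ℝ} (hv : ∀ n : d → ℤ, ∑ i, n i * v i = 0 → n = 0)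
    {U : Set (UnitAddTorus d)} (hU : IsOpen U) (hne : U.Nonempty) :
    ∃ L : ℝ, 0 < L ∧ ∀ x : ℝ, ∃ t ∈ Set.Icc x (x + L), flow v t ∈ U := by
  obtain ⟨y, hy⟩ := hne
  obtain ⟨f, hf₀, hf₁, hf⟩ := exists_continuous_zero_one_of_isClosed hU.isClosed_compl
    (isClosed_singleton (x := y)) (by simpa using hy)
  have hpos : 0 < ∫ x, f x ∂haar d :=
    f.continuous.integral_pos_of_hasCompactSupport_nonneg_nonzero
      (HasCompactSupport.of_compactSpace _) (fun x ↦ (hf x).1) (x := y) (by simp [hf₁ rfl])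
  let F : C(UnitAddTorus d, ℂ) := ⟨fun x ↦ (f x : ℂ), by fun_prop⟩
  have hF : ∫ x, F x ∂haar d = ((∫ x, f x ∂haar d : ℝ) : ℂ) := integral_ofReal
  obtain ⟨L, h, hL⟩ :=
    ((hasUniformMean_flow hv F _ (half_pos hpos)).and (eventually_gt_atTop 0)).exists
  refine ⟨L, hL, fun x ↦ ?_⟩
  by_contra! hx
  have hzero : ∫ t in x..x + L, F (flow v t) = 0 := by
    rw [intervalIntegral.integral_congr (g := fun _ ↦ 0)]
    · simp
    · intro t ht
      rw [Set.uIcc_of_le (by linarith)] at ht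
      simp [F, hf₀ (hx t ht)]
  have := h x
  rw [hzero, hF, zero_sub, norm_neg, norm_mul, Complex.norm_real, Complex.norm_real,
    norm_of_nonneg hL.le, norm_of_nonneg hpos.le] at this
  nlinarith

end UnitAddTorus

theorem Nat.Primes.sum_mul_log_eq_zero {S : Finset Nat.Primes} {n : S → ℤ}
    (h : ∑ p, n p * Real.log p.1 = 0) : n = 0 := by
  have hprod : ∏ p, ((p.1 : ℕ) : ℚ) ^ n p = 1 := by
    have hp (p : S) : (0 : ℝ) < p.1 := by exact_mod_cast p.1.2.pos
    have h₁ : Real.log (∏ p, ((p.1 : ℕ) : ℝ) ^ n p) = 0 := by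
      rw [Real.log_prod fun p _ ↦ (zpow_pos (hp p) _).ne']
      simpa [Real.log_zpow] using h
    have h₂ := Real.eq_one_of_pos_of_log_eq_zero
      (Finset.prod_pos fun p _ ↦ zpow_pos (hp p) (n p)) h₁
    refine Rat.cast_injective (α := ℝ) ?_
    push_cast
    exact h₂
  funext q
  have := Fact.mk q.1.2
  have hval (s : Finset S) : padicValRat q.1 (∏ p ∈ s, ((p.1 : ℕ) : ℚ) ^ n p) =
      ∑ p ∈ s, n p * padicValRat q.1 (p.1 : ℕ) := by
    have hp (p : S) : ((p.1 : ℕ) : ℚ) ≠ 0 := by exact_mod_cast p.1.2.ne_zero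
    induction s using Finset.cons_induction with
    | empty => simp
    | cons a s ha ih =>
      rw [Finset.prod_cons, Finset.sum_cons, padicValRat.mul (zpow_ne_zero _ (hp a))
        (Finset.prod_ne_zero_iff.mpr fun p _ ↦ zpow_ne_zero _ (hp p)), ih, padicValRat.zpow]
  have h₁ := hval Finset.univ
  rw [hprod, padicValRat.one, Finset.sum_eq_single q] at h₁
  · simpa using h₁.symm
  · intro p _ hpq
    have := Fact.mk p.1.2
    rw [padicValRat.of_nat, padicValNat_primes fun h ↦ hpq (Subtype.ext (Subtype.ext h.symm))]
    simp
  · simp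

theorem Nat.Primes.norm_cpow_neg (p : Nat.Primes) (σ t : ℝ) :
    ‖(p : ℂ) ^ (-(σ + t * Complex.I))‖ = (p : ℝ) ^ (-σ) := by
  rw [Complex.norm_natCast_cpow_of_pos p.2.pos]
  simp

theorem Nat.Primes.cpow_neg_eq (p : Nat.Primes) (σ t : ℝ) :
    (p : ℂ) ^ (-(σ + t * Complex.I)) =
      ((p : ℝ) ^ (-σ) : ℝ) * (p : ℂ) ^ (-(t * Complex.I)) := by
  rw [neg_add, Complex.cpow_add _ _ (by exact_mod_cast p.2.ne_zero),
    Complex.ofReal_cpow (by positivity)]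
  simp

theorem Nat.Primes.rpow_neg_le_half (p : Nat.Primes) {σ : ℝ} (hσ : 1 < σ) :
    (p : ℝ) ^ (-σ) ≤ 1 / 2 := by
  have h2 : (2 : ℝ) ≤ p := by exact_mod_cast p.2.two_le
  calc (p : ℝ) ^ (-σ) ≤ (p : ℝ) ^ (-1 : ℝ) := by gcongr; linarith
    _ ≤ 1 / 2 := by
      rw [Real.rpow_neg_one, one_div]
      gcongr

theorem Nat.Primes.exists_im_cpow_gt_half (S : Finset Nat.Primes) :
    ∃ L : ℝ, 0 < L ∧ ∀ x : ℝ, ∃ t ∈ Set.Icc x (x + L),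
      ∀ p ∈ S, 1 / 2 < ((p : ℂ) ^ (-(t * Complex.I))).im := by
  let v : S → ℝ := fun p ↦ -Real.log p.1 / (2 * π)
  have hv (n : S → ℤ) (h : ∑ p, n p * v p = 0) : n = 0 := by
    refine Nat.Primes.sum_mul_log_eq_zero ?_
    have : ∑ p, n p * Real.log p.1 = -(2 * π) * ∑ p, n p * v p := by
      rw [Finset.mul_sum]
      exact Finset.sum_congr rfl fun p _ ↦ by simp only [v]; field_simp
    rw [this, h, mul_zero]
  let U : Set (UnitAddTorus S) := {x | ∀ p, 1 / 2 < (fourier 1 (x p) : ℂ).im}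
  have hU : IsOpen U := by
    simp only [U, Set.ofPred_forall]
    exact isOpen_iInter_of_finite fun p ↦ isOpen_lt continuous_const
      (Complex.continuous_im.comp ((fourier 1).continuous.comp (continuous_apply p)))
  have hne : U.Nonempty := by
    refine ⟨fun _ ↦ ((1 / 4 : ℝ) : AddCircle (1 : ℝ)), fun p ↦ ?_⟩
    rw [fourier_coe_apply]
    have : 2 * (π : ℂ) * Complex.I * (1 : ℤ) * (1 / 4 : ℝ) / (1 : ℝ) = π / 2 * Complex.I := by
      push_cast
      ring
    rw [this, Complex.exp_pi_div_two_mul_I]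
    norm_num
  obtain ⟨L, hL, h⟩ := UnitAddTorus.exists_flow_mem hv hU hne
  refine ⟨L, hL, fun x ↦ ?_⟩
  obtain ⟨t, ht, htU⟩ := h x
  refine ⟨t, ht, fun p hp ↦ ?_⟩
  convert htU ⟨p, hp⟩ using 2
  simp only [UnitAddTorus.flow, v]
  rw [fourier_coe_apply, Complex.cpow_def_of_ne_zero (by exact_mod_cast p.2.ne_zero),
    ← Complex.natCast_log]
  congr 1
  have : (π : ℂ) ≠ 0 := by exact_mod_cast pi_ne_zero
  push_cast
  field_simp

/-- The continuous argument of `ζ(σ + it)`, `σ > 1`, given by the logarithm of the Euler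
product. -/
noncomputable def zetaArg (t σ : ℝ) : ℝ :=
  (∑' p : Nat.Primes, -Complex.log (1 - (p : ℂ) ^ (-(σ + t * Complex.I)))).im

theorem norm_log_one_sub_primes_cpow_le (p : Nat.Primes) (t : ℝ) {σ : ℝ} (hσ : 1 < σ) :
    ‖-Complex.log (1 - (p : ℂ) ^ (-(σ + t * Complex.I)))‖ ≤ 3 / 2 * (p : ℝ) ^ (-σ) := by
  have h := p.norm_cpow_neg σ t
  rw [norm_neg, sub_eq_add_neg, ← h, ← norm_neg ((p : ℂ) ^ _)]
  refine Complex.norm_log_one_add_half_le_self ?_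
  rw [norm_neg, h]
  exact p.rpow_neg_le_half hσ

theorem summable_three_halves_mul_primes_rpow_neg {σ : ℝ} (hσ : 1 < σ) :
    Summable fun p : Nat.Primes ↦ 3 / 2 * (p : ℝ) ^ (-σ) :=
  (Nat.Primes.summable_rpow.mpr (by linarith)).mul_left _

theorem summable_log_one_sub_primes_cpow (t : ℝ) {σ : ℝ} (hσ : 1 < σ) :
    Summable fun p : Nat.Primes ↦
      -Complex.log (1 - (p : ℂ) ^ (-(σ + t * Complex.I))) :=
  (summable_three_halves_mul_primes_rpow_neg hσ).of_norm_bounded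
    fun p ↦ norm_log_one_sub_primes_cpow_le p t hσ

theorem abs_zetaArg_le (t : ℝ) {σ : ℝ} (hσ : 1 < σ) :
    |zetaArg t σ| ≤ ∑' p : Nat.Primes, 3 / 2 * (p : ℝ) ^ (-σ) :=
  (Complex.abs_im_le_norm _).trans <|
    tsum_of_norm_bounded (summable_three_halves_mul_primes_rpow_neg hσ).hasSum
      fun p ↦ norm_log_one_sub_primes_cpow_le p t hσ

theorem riemannZeta_eq_norm_mul_exp_zetaArg (t : ℝ) {σ : ℝ} (hσ : 1 < σ) :
    riemannZeta (σ + t * Complex.I) =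
      ‖riemannZeta (σ + t * Complex.I)‖ * Complex.exp (zetaArg t σ * Complex.I) := by
  rw [← riemannZeta_eulerProduct_exp_log (by simpa using hσ), Complex.norm_exp,
    Complex.ofReal_exp, ← Complex.exp_add, zetaArg, Complex.re_add_im]

theorem continuousOn_zetaArg (t : ℝ) : ContinuousOn (zetaArg t) (Set.Ioi 1) := by
  intro σ hσ
  obtain ⟨a, ha, haσ⟩ := exists_between (Set.mem_Ioi.mp hσ)
  have key : ContinuousOn (fun σ : ℝ ↦
      ∑' p : Nat.Primes, -Complex.log (1 - (p : ℂ) ^ (-(σ + t * Complex.I)))) (Set.Ioi a) := by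
    refine continuousOn_tsum (fun p x hx ↦ ContinuousAt.continuousWithinAt ?_)
      (summable_three_halves_mul_primes_rpow_neg ha) fun p x hx ↦ ?_
    · have hp : (p : ℂ) ≠ 0 := by exact_mod_cast p.2.ne_zero
      have : NeZero (p : ℂ) := ⟨hp⟩
      refine ContinuousAt.neg (ContinuousAt.clog (by fun_prop) ?_)
      rw [sub_eq_add_neg]
      refine Complex.mem_slitPlane_of_norm_lt_one ?_
      rw [norm_neg, p.norm_cpow_neg]
      linarith [p.rpow_neg_le_half (ha.trans hx)]
    · refine (norm_log_one_sub_primes_cpow_le p t (ha.trans hx)).trans ?_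
      have h1 : (1 : ℝ) ≤ p := by exact_mod_cast p.2.one_le
      have : a ≤ x := le_of_lt hx
      gcongr
  exact (Complex.continuous_im.continuousAt.comp
    (key.continuousAt (Ioi_mem_nhds haσ))).continuousWithinAt

theorem im_sub_norm_sq_le_im_neg_log {z : ℂ} (hz : ‖z‖ ≤ 1 / 2) :
    z.im - ‖z‖ ^ 2 ≤ (-Complex.log (1 - z)).im := by
  have h₁ := Complex.norm_log_one_add_sub_self_le (z := -z) (by rw [norm_neg]; linarith)
  rw [norm_neg, ← sub_eq_add_neg] at h₁
  have h₂ : (1 - ‖z‖)⁻¹ ≤ 2 := by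
    rw [inv_le_comm₀ (by linarith) two_pos]
    linarith
  have h₃ : ‖z‖ ^ 2 * (1 - ‖z‖)⁻¹ / 2 ≤ ‖z‖ ^ 2 := by nlinarith [sq_nonneg ‖z‖]
  have h₄ := (le_abs_self _).trans ((Complex.abs_im_le_norm _).trans (h₁.trans h₃))
  simp only [Complex.sub_im, Complex.neg_im] at h₄ ⊢
  linarith

theorem le_zetaArg {S : Finset Nat.Primes} {t σ : ℝ} (hσ : 1 < σ)
    (ht : ∀ p ∈ S, 1 / 2 < ((p : ℂ) ^ (-(t * Complex.I))).im) :
    3 / 2 * ∑ p ∈ S, (p : ℝ) ^ (-σ) - ∑' p : Nat.Primes, (p : ℝ) ^ (-σ) -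
      ∑' p : Nat.Primes, (p : ℝ) ^ (-2 : ℝ) ≤ zetaArg t σ := by
  classical
  have hS : HasSum (fun p : Nat.Primes ↦ if p ∈ S then 3 / 2 * (p : ℝ) ^ (-σ) else 0)
      (3 / 2 * ∑ p ∈ S, (p : ℝ) ^ (-σ)) := by
    rw [Finset.mul_sum, ← Finset.sum_congr rfl fun p hp ↦ if_pos hp]
    exact hasSum_sum_of_ne_finset_zero fun p hp ↦ if_neg hp
  have hσ' := (Nat.Primes.summable_rpow (r := -σ)).mpr (by linarith)
  have h2 := (Nat.Primes.summable_rpow (r := -2)).mpr (by norm_num)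
  refine hasSum_le (fun p ↦ ?_) ((hS.sub hσ'.hasSum).sub h2.hasSum)
    (Complex.hasSum_im (summable_log_one_sub_primes_cpow t hσ).hasSum)
  have hp1 : (1 : ℝ) ≤ p := by exact_mod_cast p.2.one_le
  have hnorm := p.norm_cpow_neg σ t
  refine le_trans ?_ (im_sub_norm_sq_le_im_neg_log (hnorm.le.trans (p.rpow_neg_le_half hσ)))
  rw [hnorm]
  have hsq : ((p : ℝ) ^ (-σ)) ^ 2 ≤ (p : ℝ) ^ (-2 : ℝ) := by
    rw [← Real.rpow_mul_natCast (by positivity)]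
    gcongr
    push_cast
    linarith
  have hpos : 0 < (p : ℝ) ^ (-σ) := by positivity
  split_ifs with hp
  · rw [p.cpow_neg_eq, Complex.im_ofReal_mul]
    nlinarith [ht p hp]
  · have := (abs_le.mp (Complex.abs_im_le_norm ((p : ℂ) ^ (-(σ + t * Complex.I))))).1
    linarith

/-- The prime zeta function is unbounded near `1`, already on finite sets of primes which carry
almost all of its mass. -/
theorem Nat.Primes.exists_finset_sum_rpow_gt (C : ℝ) {σ₀ : ℝ} (hσ₀ : 1 < σ₀) :
    ∃ σ ∈ Set.Ioo 1 σ₀, ∃ S : Finset Nat.Primes, C < ∑ p ∈ S, (p : ℝ) ^ (-σ) ∧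
      ∑' p : Nat.Primes, (p : ℝ) ^ (-σ) < ∑ p ∈ S, (p : ℝ) ^ (-σ) + 1 := by
  classical
  obtain ⟨S₀, hS₀⟩ : ∃ S₀ : Finset Nat.Primes, C < ∑ p ∈ S₀, (p : ℝ) ^ (-1 : ℝ) := by
    by_contra! h
    refine Nat.Primes.not_summable_one_div (summable_of_sum_le (c := C) (fun p ↦ by positivity) ?_)
    simpa [Real.rpow_neg_one] using h
  have hcont : Continuous fun σ : ℝ ↦ ∑ p ∈ S₀, (p : ℝ) ^ (-σ) :=
    continuous_finsetSum _ fun p _ ↦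
      Continuous.rpow continuous_const continuous_neg fun _ ↦
        Or.inl (by exact_mod_cast p.2.ne_zero)
  have hev := hcont.continuousWithinAt (s := Set.Ioi 1) (x := 1) |>.eventually (lt_mem_nhds hS₀)
  obtain ⟨σ, hσS, hσ⟩ := (hev.and (Ioo_mem_nhdsGT hσ₀)).exists
  have hsum := (Nat.Primes.summable_rpow (r := -σ)).mpr (by linarith [hσ.1])
  obtain ⟨S, hSS, hS⟩ := ((Filter.eventually_ge_atTop S₀).and
    (hsum.hasSum.eventually (lt_mem_nhds (_root_.sub_one_lt _)))).exists
  refine ⟨σ, hσ, S, hσS.trans_le ?_, by linarith⟩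
  exact Finset.sum_le_sum_of_subset_of_nonneg hSS fun p _ _ ↦ by positivity

/-- Let `σ₀ > 1` and `n ∈ ℕ`. There is a relatively dense set `T ⊆ ℝ` such that
for every `t ∈ T` the parametrized curve `σ ↦ ζ(σ + it)`, `σ ∈ (1, σ₀)`, makes
at least `n` turns around the origin: there is a continuous argument function
`φ` on `(1, σ₀)` whose total variation exceeds `2πn`. -/
theorem vortex_behavior_riemannZeta (σ₀ : ℝ) (hσ₀ : 1 < σ₀) (n : ℕ) :
    ∃ T : Set ℝ,
      (∃ L : ℝ, 0 < L ∧ ∀ x : ℝ, ∃ t ∈ T, t ∈ Set.Icc x (x + L)) ∧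
      ∀ t ∈ T, ∃ φ : ℝ → ℝ,
        ContinuousOn φ (Set.Ioo 1 σ₀) ∧
        (∀ σ ∈ Set.Ioo 1 σ₀,
          riemannZeta (σ + t * Complex.I) =
            (‖riemannZeta (σ + t * Complex.I)‖ : ℂ) *
              Complex.exp ((φ σ : ℂ) * Complex.I)) ∧
        ∃ σ₁ ∈ Set.Ioo 1 σ₀, ∃ σ₂ ∈ Set.Ioo 1 σ₀,
          φ σ₁ - φ σ₂ ≥ 2 * π * n := by
  set σ₂ := (1 + σ₀) / 2 with hσ₂_def
  have hσ₂ : σ₂ ∈ Set.Ioo 1 σ₀ := ⟨by linarith, by linarith⟩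
  set B := ∑' p : Nat.Primes, 3 / 2 * (p : ℝ) ^ (-σ₂)
  set K := ∑' p : Nat.Primes, (p : ℝ) ^ (-2 : ℝ)
  obtain ⟨σ₁, hσ₁, S, hS, hS'⟩ :=
    Nat.Primes.exists_finset_sum_rpow_gt (2 * (2 * π * n + B + K + 1)) hσ₀
  refine ⟨{t | ∀ p ∈ S, 1 / 2 < ((p : ℂ) ^ (-(t * Complex.I))).im}, ?_, fun t ht ↦
    ⟨zetaArg t, (continuousOn_zetaArg t).mono Set.Ioo_subset_Ioi_self,
      fun σ hσ ↦ riemannZeta_eq_norm_mul_exp_zetaArg t hσ.1, σ₁, hσ₁, σ₂, hσ₂, ?_⟩⟩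
  · obtain ⟨L, hL, h⟩ := Nat.Primes.exists_im_cpow_gt_half S
    exact ⟨L, hL, fun x ↦ (h x).imp fun t ht ↦ ht.symm⟩
  · have h₁ := le_zetaArg hσ₁.1 ht
    have h₂ := (abs_le.mp (abs_zetaArg_le t hσ₂.1)).2
    linarith
end
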